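/- arXiv:2111.10331 — 6 statements merged into one kernel-verified Lean document; each statement's English description precedes it below -/
import Mathlib

section
/- For every odd integer n > 1, there is exactly one nonattacking placement of ⌈n/2⌉² kings on the n×n chessboard, namely the set {(2i, 2j) : 0 ≤ i, j ≤ (n−1)/2} (0-indexed), which places kings in all four corners and in alternating rows and columns. -/
open scoped Classical

/-- A placement of kings on an `m × n` board (positions 0-indexed) is nonattacking
if any two distinct positions are at Chebyshev distance at least 2. -/
def Nonattacking {m n : ℕ} (S : Finset (Fin m × Fin n)) : Prop :=
  ∀ p ∈ S, ∀ q ∈ S, p ≠ q →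
    2 ≤ max (Nat.dist (p.1 : ℕ) (q.1 : ℕ)) (Nat.dist (p.2 : ℕ) (q.2 : ℕ))

/-- Two kings of a nonattacking placement whose coordinates differ by at most one coincide. -/
theorem Nonattacking.eq_of_near {m n : ℕ} {S : Finset (Fin m × Fin n)} (hS : Nonattacking S)
    {p q : Fin m × Fin n} (hp : p ∈ S) (hq : q ∈ S)
    (h₁ : (p.1 : ℕ) ≤ q.1 + 1 ∧ (q.1 : ℕ) ≤ p.1 + 1)
    (h₂ : (p.2 : ℕ) ≤ q.2 + 1 ∧ (q.2 : ℕ) ≤ p.2 + 1) : p = q := by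
  by_contra hne
  have h := hS p hp q hq hne
  simp only [Nat.dist] at h
  omega

/-- The block containing a square, when the rows and the columns are both partitioned as
`{0}, {1, 2}, …, {2k - 1, 2k}`. -/
def kingBlock {k : ℕ} (p : Fin (2 * k + 1) × Fin (2 * k + 1)) : Fin (k + 1) × Fin (k + 1) :=
  (⟨(p.1 + 1) / 2, by omega⟩, ⟨(p.2 + 1) / 2, by omega⟩)

theorem kingBlock_eq_iff {k : ℕ} {p : Fin (2 * k + 1) × Fin (2 * k + 1)}
    {b : Fin (k + 1) × Fin (k + 1)} :
    kingBlock p = b ↔ ((p.1 : ℕ) + 1) / 2 = b.1 ∧ ((p.2 : ℕ) + 1) / 2 = b.2 := by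
  simp [kingBlock, Prod.ext_iff, Fin.ext_iff]

theorem Nonattacking.injOn_kingBlock {k : ℕ} {S : Finset (Fin (2 * k + 1) × Fin (2 * k + 1))}
    (hS : Nonattacking S) : Set.InjOn kingBlock (S : Set (Fin (2 * k + 1) × Fin (2 * k + 1))) := by
  intro p hp q hq h
  rw [kingBlock_eq_iff] at h
  simp only [kingBlock] at h
  exact hS.eq_of_near hp hq (by omega) (by omega)

/-- A nonattacking placement of `(k + 1) ^ 2` kings has a king in every block. -/
theorem Nonattacking.exists_mem_block {k : ℕ} {S : Finset (Fin (2 * k + 1) × Fin (2 * k + 1))}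
    (hS : Nonattacking S) (hcard : S.card = (k + 1) ^ 2) {i j : ℕ} (hi : i ≤ k) (hj : j ≤ k) :
    ∃ p ∈ S, ((p.1 : ℕ) + 1) / 2 = i ∧ ((p.2 : ℕ) + 1) / 2 = j := by
  have himage : S.image kingBlock = Finset.univ := by
    rw [← Finset.card_eq_iff_eq_univ, Finset.card_image_of_injOn hS.injOn_kingBlock, hcard]
    simp [sq]
  have hmem : ((⟨i, by omega⟩, ⟨j, by omega⟩) : Fin (k + 1) × Fin (k + 1)) ∈ S.image kingBlock := by
    simp [himage]
  obtain ⟨p, hp, h⟩ := Finset.mem_image.mp hmem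
  exact ⟨p, hp, kingBlock_eq_iff.mp h⟩

theorem Nonattacking.exists_mem_even_row {k : ℕ} {S : Finset (Fin (2 * k + 1) × Fin (2 * k + 1))}
    (hS : Nonattacking S) (hcard : S.card = (k + 1) ^ 2) {i j : ℕ} (hi : i ≤ k) (hj : j ≤ k) :
    ∃ p ∈ S, (p.1 : ℕ) = 2 * i ∧ ((p.2 : ℕ) + 1) / 2 = j := by
  induction i with
  | zero =>
    obtain ⟨p, hp, h₁, h₂⟩ := hS.exists_mem_block hcard hi hj
    exact ⟨p, hp, by omega, h₂⟩
  | succ i ih =>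
    obtain ⟨q, hq, hq₁, hq₂⟩ := ih (by omega)
    obtain ⟨p, hp, h₁, h₂⟩ := hS.exists_mem_block hcard hi hj
    refine ⟨p, hp, ?_, h₂⟩
    by_contra hne
    have := hS.eq_of_near hp hq (by omega) (by omega)
    subst this
    omega

theorem Nonattacking.exists_mem_even {k : ℕ} {S : Finset (Fin (2 * k + 1) × Fin (2 * k + 1))}
    (hS : Nonattacking S) (hcard : S.card = (k + 1) ^ 2) {i j : ℕ} (hi : i ≤ k) (hj : j ≤ k) :
    ∃ p ∈ S, (p.1 : ℕ) = 2 * i ∧ (p.2 : ℕ) = 2 * j := by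
  induction j with
  | zero =>
    obtain ⟨p, hp, h₁, h₂⟩ := hS.exists_mem_even_row hcard hi hj
    exact ⟨p, hp, h₁, by omega⟩
  | succ j ih =>
    obtain ⟨q, hq, hq₁, hq₂⟩ := ih (by omega)
    obtain ⟨p, hp, h₁, h₂⟩ := hS.exists_mem_even_row hcard hi hj
    refine ⟨p, hp, h₁, ?_⟩
    by_contra hne
    have := hS.eq_of_near hp hq (by omega) (by omega)
    subst this
    omega

/-- For odd `n > 1`, the unique maximum nonattacking placement of kings on the
`n × n` board is `{(2i, 2j) : 0 ≤ i, j ≤ (n-1)/2}`. -/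
theorem unique_max_kings_odd (n : ℕ) (hn : 1 < n) (hodd : Odd n) :
    ∀ S : Finset (Fin n × Fin n),
      (Nonattacking S ∧ S.card = ((n + 1) / 2) ^ 2) ↔
      S = Finset.univ.filter
        (fun p : Fin n × Fin n => ∃ i ≤ (n - 1) / 2, ∃ j ≤ (n - 1) / 2,
          (p.1 : ℕ) = 2 * i ∧ (p.2 : ℕ) = 2 * j) := by
  obtain ⟨k, rfl⟩ := hodd
  have hhalf : (2 * k + 1 + 1) / 2 = k + 1 := by omega
  have hpred : (2 * k + 1 - 1) / 2 = k := by omega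
  intro S
  rw [hhalf, hpred]
  constructor
  · rintro ⟨hS, hcard⟩
    ext p
    simp only [Finset.mem_filter, Finset.mem_univ, true_and]
    constructor
    · intro hp
      obtain ⟨q, hq, h₁, h₂⟩ := hS.exists_mem_even hcard (i := (p.1 + 1) / 2)
        (j := (p.2 + 1) / 2) (by omega) (by omega)
      obtain rfl := hS.eq_of_near hp hq (by omega) (by omega)
      exact ⟨_, by omega, _, by omega, h₁, h₂⟩
    · rintro ⟨i, hi, j, hj, h₁, h₂⟩
      obtain ⟨q, hq, hq₁, hq₂⟩ := hS.exists_mem_even hcard hi hj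
      obtain rfl : p = q := Prod.ext (Fin.ext (by omega)) (Fin.ext (by omega))
      exact hq
  · intro h
    have hmem (p) : p ∈ S ↔ ∃ i ≤ k, ∃ j ≤ k, (p.1 : ℕ) = 2 * i ∧ (p.2 : ℕ) = 2 * j := by
      simp [h]
    have hS : Nonattacking S := by
      intro p hp q hq hne
      obtain ⟨i, _, j, _, hp₁, hp₂⟩ := (hmem p).mp hp
      obtain ⟨i', _, j', _, hq₁, hq₂⟩ := (hmem q).mp hq
      by_contra hlt
      simp only [Nat.dist] at hlt
      exact hne (Prod.ext (Fin.ext (by omega)) (Fin.ext (by omega)))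
    refine ⟨hS, ?_⟩
    have himage : S.image kingBlock = Finset.univ := by
      refine Finset.eq_univ_of_forall fun b => Finset.mem_image.mpr
        ⟨(⟨2 * b.1, by omega⟩, ⟨2 * b.2, by omega⟩), (hmem _).mpr ?_, ?_⟩
      · exact ⟨b.1, by omega, b.2, by omega, rfl, rfl⟩
      · rw [kingBlock_eq_iff]
        constructor <;> dsimp only <;> omega
    rw [← Finset.card_image_of_injOn hS.injOn_kingBlock, himage]
    simp [sq]
end

section
/- For every n ≥ 1, the map (A, k) ↦ S(A,k), defined on pairs with A ⊆ {1,…,n} and 1 ≤ k ≤ n+1, is a bijection onto the set of all nonattacking placements of exactly n kings on the 2×2n strip; in other words, every nonattacking placement of n kings on the 2×2n strip equals S(A,k) for exactly one pair (A,k). -/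
/-- Membership predicate for the placement `S(A,k)` on the `2 × 2n` strip:
one king in each 2×2 block `i` (1-indexed; its 0-indexed columns are `2i-2` (left)
and `2i-1` (right)): in the top row (row 0) if `i ∈ A`, the bottom row (row 1)
otherwise; in the left column of its block if `i < k`, the right column if `i ≥ k`. -/
def kingPred (n : ℕ) (A : Finset ℕ) (k : ℕ) (p : Fin 2 × Fin (2 * n)) : Prop :=
  ∃ i ∈ Finset.Icc 1 n,
    (p.1 : ℕ) = (if i ∈ A then 0 else 1) ∧
    (p.2 : ℕ) = (if i < k then 2 * i - 2 else 2 * i - 1)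

instance (n : ℕ) (A : Finset ℕ) (k : ℕ) : DecidablePred (kingPred n A k) :=
  fun _ => by unfold kingPred; infer_instance

/-- The placement `S(A,k)` on the `2 × 2n` strip. -/
def kingPlacement (n : ℕ) (A : Finset ℕ) (k : ℕ) : Finset (Fin 2 × Fin (2 * n)) :=
  Finset.univ.filter (kingPred n A k)

/-- The 1-indexed `2 × 2` block containing a position. -/
def blockIndex {n : ℕ} (p : Fin 2 × Fin (2 * n)) : ℕ := (p.2 : ℕ) / 2 + 1

theorem blockIndex_mem {n : ℕ} (p : Fin 2 × Fin (2 * n)) : blockIndex p ∈ Finset.Icc 1 n := by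
  have := p.2.isLt
  simp only [blockIndex, Finset.mem_Icc]
  omega

theorem mem_kingPlacement {n : ℕ} {A : Finset ℕ} {k : ℕ} {p : Fin 2 × Fin (2 * n)} :
    p ∈ kingPlacement n A k ↔
      ((p.1 : ℕ) = 0 ↔ blockIndex p ∈ A) ∧ ((p.2 : ℕ) % 2 = 0 ↔ blockIndex p < k) := by
  have h1 := p.1.isLt
  simp only [kingPlacement, Finset.mem_filter, Finset.mem_univ, true_and, kingPred]
  constructor
  · rintro ⟨i, hi, hr, hc⟩
    rw [Finset.mem_Icc] at hi
    have hb : blockIndex p = i := by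
      unfold blockIndex
      split_ifs at hc <;> omega
    rw [hb]
    constructor
    · split_ifs at hr with h <;> simp [hr, h]
    · split_ifs at hc with h <;> simp only [h, iff_true, iff_false] <;> omega
  · rintro ⟨hr, hc⟩
    refine ⟨blockIndex p, blockIndex_mem p, ?_, ?_⟩
    · split_ifs with h <;> simp only [h, iff_true, iff_false] at hr <;> omega
    · split_ifs with h <;> simp only [h, iff_true, iff_false] at hc <;>
        unfold blockIndex <;> omega

theorem exists_mem_kingPlacement {n i : ℕ} (hi : i ∈ Finset.Icc 1 n) (A : Finset ℕ) (k : ℕ) :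
    ∃ p ∈ kingPlacement n A k, blockIndex p = i := by
  rw [Finset.mem_Icc] at hi
  let p : Fin 2 × Fin (2 * n) :=
    (⟨if i ∈ A then 0 else 1, by split_ifs <;> omega⟩,
      ⟨if i < k then 2 * i - 2 else 2 * i - 1, by split_ifs <;> omega⟩)
  have hp : p ∈ kingPlacement n A k := by
    simp only [kingPlacement, Finset.mem_filter, Finset.mem_univ, true_and]
    exact ⟨i, Finset.mem_Icc.2 hi, rfl, rfl⟩
  refine ⟨p, hp, ?_⟩
  simp only [blockIndex, p]
  split_ifs <;> omega

/-- Nonattacking kings on the strip never occupy columns at distance at most one. -/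
theorem Nonattacking.two_le_dist {n : ℕ} {S : Finset (Fin 2 × Fin (2 * n))}
    (hS : Nonattacking S) {p q : Fin 2 × Fin (2 * n)} (hp : p ∈ S) (hq : q ∈ S) (hpq : p ≠ q) :
    2 ≤ Nat.dist (p.2 : ℕ) (q.2 : ℕ) := by
  have h := hS p hp q hq hpq
  have h1 := p.1.isLt
  have h2 := q.1.isLt
  have h3 : Nat.dist (p.1 : ℕ) (q.1 : ℕ) < 2 := by unfold Nat.dist; omega
  omega

theorem Nonattacking.blockIndex_injOn {n : ℕ} {S : Finset (Fin 2 × Fin (2 * n))}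
    (hS : Nonattacking S) : Set.InjOn blockIndex (S : Set (Fin 2 × Fin (2 * n))) := by
  intro p hp q hq h
  by_contra hpq
  have := hS.two_le_dist hp hq hpq
  unfold Nat.dist at this
  unfold blockIndex at h
  omega

theorem nonattacking_kingPlacement (n : ℕ) (A : Finset ℕ) (k : ℕ) :
    Nonattacking (kingPlacement n A k) := by
  intro p hp q hq hpq
  rw [mem_kingPlacement] at hp hq
  refine le_max_of_le_right ?_
  have h1 := p.1.isLt
  have h2 := q.1.isLt
  by_cases hb : blockIndex p = blockIndex q
  · refine absurd (Prod.ext (Fin.ext ?_) (Fin.ext ?_)) hpq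
    · rw [hb] at hp
      have := hp.1.trans hq.1.symm
      omega
    · rw [hb] at hp
      have := hp.2.trans hq.2.symm
      unfold blockIndex at hb
      omega
  · have hp2 := hp.2
    have hq2 := hq.2
    unfold blockIndex at hb hp2 hq2
    unfold Nat.dist
    omega

theorem card_kingPlacement (n : ℕ) (A : Finset ℕ) (k : ℕ) : (kingPlacement n A k).card = n := by
  have h : (kingPlacement n A k).image blockIndex = Finset.Icc 1 n := by
    ext i
    rw [Finset.mem_image]
    constructor
    · rintro ⟨p, -, rfl⟩
      exact blockIndex_mem p
    · exact fun hi => exists_mem_kingPlacement hi A k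
  rw [← Finset.card_image_of_injOn (nonattacking_kingPlacement n A k).blockIndex_injOn, h,
    Nat.card_Icc, Nat.add_sub_cancel]

theorem kingPlacement_injective {n : ℕ} {A B : Finset ℕ} {k l : ℕ} (hA : A ⊆ Finset.Icc 1 n)
    (hB : B ⊆ Finset.Icc 1 n) (hk : k ∈ Finset.Icc 1 (n + 1)) (hl : l ∈ Finset.Icc 1 (n + 1))
    (h : kingPlacement n A k = kingPlacement n B l) : A = B ∧ k = l := by
  have key : ∀ i ∈ Finset.Icc 1 n, (i ∈ A ↔ i ∈ B) ∧ (i < k ↔ i < l) := by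
    intro i hi
    obtain ⟨p, hp, rfl⟩ := exists_mem_kingPlacement hi A k
    have hq := hp
    rw [h, mem_kingPlacement] at hq
    rw [mem_kingPlacement] at hp
    exact ⟨hp.1.symm.trans hq.1, hp.2.symm.trans hq.2⟩
  constructor
  · ext i
    exact ⟨fun hi => ((key i (hA hi)).1).1 hi, fun hi => ((key i (hB hi)).1).2 hi⟩
  · rw [Finset.mem_Icc] at hk hl
    rcases lt_trichotomy k l with hkl | hkl | hkl
    · have := (key k (Finset.mem_Icc.2 (by omega))).2
      omega
    · exact hkl
    · have := (key l (Finset.mem_Icc.2 (by omega))).2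
      omega

/-- In a nonattacking placement of `n` kings every block is occupied. -/
theorem Nonattacking.exists_blockIndex_eq {n : ℕ} {S : Finset (Fin 2 × Fin (2 * n))}
    (hS : Nonattacking S) (hc : S.card = n) {i : ℕ} (hi : i ∈ Finset.Icc 1 n) :
    ∃ p ∈ S, blockIndex p = i := by
  have h : S.image blockIndex = Finset.Icc 1 n := by
    apply Finset.eq_of_subset_of_card_le
    · exact Finset.image_subset_iff.2 fun p _ => blockIndex_mem p
    · rw [Finset.card_image_of_injOn hS.blockIndex_injOn, hc, Nat.card_Icc, Nat.add_sub_cancel]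
  rwa [← h, Finset.mem_image] at hi

/-- To the right of a king in the right column of its block, all kings are in right columns. -/
theorem Nonattacking.odd_of_blockIndex_le {n : ℕ} {S : Finset (Fin 2 × Fin (2 * n))}
    (hS : Nonattacking S) (hc : S.card = n) {p : Fin 2 × Fin (2 * n)} (hp : p ∈ S)
    (hodd : (p.2 : ℕ) % 2 = 1) {q : Fin 2 × Fin (2 * n)} (hq : q ∈ S)
    (hpq : blockIndex p ≤ blockIndex q) : (q.2 : ℕ) % 2 = 1 := by
  obtain ⟨d, hd⟩ := Nat.exists_eq_add_of_le hpq
  clear hpq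
  induction d generalizing q with
  | zero => rwa [hS.blockIndex_injOn hq hp hd]
  | succ d ih =>
    have hmem := Finset.mem_Icc.1 (blockIndex_mem q)
    have hmem' := Finset.mem_Icc.1 (blockIndex_mem p)
    obtain ⟨r, hr, hrd⟩ := hS.exists_blockIndex_eq hc
      (i := blockIndex p + d) (Finset.mem_Icc.2 (by omega))
    have hr1 := ih hr hrd
    have hrq : r ≠ q := by
      rintro rfl
      omega
    have := hS.two_le_dist hr hq hrq
    unfold Nat.dist at this
    unfold blockIndex at hd hrd
    omega

theorem Nonattacking.exists_eq_kingPlacement {n : ℕ} {S : Finset (Fin 2 × Fin (2 * n))}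
    (hS : Nonattacking S) (hc : S.card = n) :
    ∃ A ⊆ Finset.Icc 1 n, ∃ k ∈ Finset.Icc 1 (n + 1), S = kingPlacement n A k := by
  classical
  have hex : ∃ k, 1 ≤ k ∧ ∀ p ∈ S, k ≤ blockIndex p → (p.2 : ℕ) % 2 = 1 := by
    refine ⟨n + 1, by omega, fun p _ h => ?_⟩
    have := Finset.mem_Icc.1 (blockIndex_mem p)
    omega
  refine ⟨(S.filter fun p => (p.1 : ℕ) = 0).image blockIndex,
    Finset.image_subset_iff.2 fun p _ => blockIndex_mem p, Nat.find hex,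
    Finset.mem_Icc.2 ⟨(Nat.find_spec hex).1, Nat.find_min' hex ⟨by omega, fun p _ h => ?_⟩⟩, ?_⟩
  · have := Finset.mem_Icc.1 (blockIndex_mem p)
    omega
  · apply Finset.eq_of_subset_of_card_le
    · intro p hp
      rw [mem_kingPlacement]
      refine ⟨⟨fun h => Finset.mem_image_of_mem _ (Finset.mem_filter.2 ⟨hp, h⟩), fun h => ?_⟩,
        fun h => ?_, fun h => ?_⟩
      · obtain ⟨q, hq, hqp⟩ := Finset.mem_image.1 h
        rw [Finset.mem_filter] at hq
        rw [← hS.blockIndex_injOn hq.1 hp hqp]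
        exact hq.2
      · by_contra hlt
        have := (Nat.find_spec hex).2 p hp (not_lt.1 hlt)
        omega
      · by_contra hne
        exact Nat.find_min hex h ⟨(Finset.mem_Icc.1 (blockIndex_mem p)).1,
          fun q hq => hS.odd_of_blockIndex_le hc hp (by omega) hq⟩
    · rw [card_kingPlacement, hc]

/-- Every nonattacking placement of `n` kings on the `2 × 2n` strip equals `S(A,k)`
for exactly one pair `(A, k)` with `A ⊆ {1,…,n}` and `1 ≤ k ≤ n+1`, and conversely
every such `S(A,k)` is a nonattacking placement of `n` kings. -/
theorem strip_bijection (n : ℕ) (hn : 1 ≤ n) :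
    (∀ A ⊆ Finset.Icc 1 n, ∀ k ∈ Finset.Icc 1 (n + 1),
      Nonattacking (kingPlacement n A k) ∧ (kingPlacement n A k).card = n) ∧
    (∀ S : Finset (Fin 2 × Fin (2 * n)), Nonattacking S → S.card = n →
      ∃! Ak : Finset ℕ × ℕ, Ak.1 ⊆ Finset.Icc 1 n ∧ Ak.2 ∈ Finset.Icc 1 (n + 1) ∧
        S = kingPlacement n Ak.1 Ak.2) := by
  refine ⟨fun A _ k _ => ⟨nonattacking_kingPlacement n A k, card_kingPlacement n A k⟩,
    fun S hS hc => ?_⟩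
  obtain ⟨A, hA, k, hk, h⟩ := hS.exists_eq_kingPlacement hc
  refine ⟨(A, k), ⟨hA, hk, h⟩, ?_⟩
  rintro ⟨B, l⟩ ⟨hB, hl, h'⟩
  obtain ⟨hAB, hkl⟩ := kingPlacement_injective hB hA hl hk (h'.symm.trans h)
  exact Prod.ext hAB hkl
end

section
/- For every n ≥ 1, the number of nonattacking placements of exactly n kings on the 2×2n strip is 2^n (n+1). -/
/-- Placements of `k` kings in the first `m` columns of the two-row strip `Fin 2 × ℕ`,
any two distinct kings being at least two columns apart. -/
def stripPlacements (m k : ℕ) : Set (Finset (Fin 2 × ℕ)) :=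
  {S | (∀ p ∈ S, p.2 < m) ∧
    (∀ p ∈ S, ∀ q ∈ S, p ≠ q → p.2 + 2 ≤ q.2 ∨ q.2 + 2 ≤ p.2) ∧ S.card = k}

theorem stripPlacements_zero_right (m : ℕ) : stripPlacements m 0 = {∅} := by
  ext S
  simp only [stripPlacements, Set.mem_ofPred_eq, Set.mem_singleton_iff, Finset.card_eq_zero]
  constructor
  · exact fun h => h.2.2
  · rintro rfl
    simp

theorem stripPlacements_zero_left_succ (k : ℕ) : stripPlacements 0 (k + 1) = ∅ := by
  refine Set.eq_empty_iff_forall_notMem.2 fun S ⟨h, _, hc⟩ => ?_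
  obtain ⟨p, hp⟩ := Finset.card_pos.1 (by omega : 0 < S.card)
  exact absurd (h p hp) (by omega)

theorem notMem_of_mem_stripPlacements {m k : ℕ} {S : Finset (Fin 2 × ℕ)}
    (hS : S ∈ stripPlacements m k) {p : Fin 2 × ℕ} (hp : m ≤ p.2) : p ∉ S :=
  fun h => absurd (hS.1 p h) (by omega)

theorem insert_mem_stripPlacements {m k : ℕ} {S : Finset (Fin 2 × ℕ)}
    (hS : S ∈ stripPlacements (m - 1) k) (i : Fin 2) :
    insert (i, m) S ∈ stripPlacements (m + 1) (k + 1) := by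
  have hn : (i, m) ∉ S := notMem_of_mem_stripPlacements hS (Nat.sub_le m 1)
  obtain ⟨hb, hs, hc⟩ := hS
  refine ⟨fun p hp => ?_, fun p hp q hq hpq => ?_, by rw [Finset.card_insert_of_notMem hn, hc]⟩
  · rcases Finset.mem_insert.1 hp with rfl | hp
    · exact Nat.lt_succ_self m
    · have := hb p hp
      omega
  · rcases Finset.mem_insert.1 hp with rfl | hp <;> rcases Finset.mem_insert.1 hq with rfl | hq
    · exact absurd rfl hpq
    · have := hb q hq
      right
      dsimp only
      omega
    · have := hb p hp
      left
      dsimp only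
      omega
    · exact hs p hp q hq hpq

theorem erase_mem_stripPlacements {m k : ℕ} {S : Finset (Fin 2 × ℕ)}
    (hS : S ∈ stripPlacements (m + 1) (k + 1)) {i : Fin 2} (hi : (i, m) ∈ S) :
    S.erase (i, m) ∈ stripPlacements (m - 1) k := by
  obtain ⟨hb, hs, hc⟩ := hS
  refine ⟨fun p hp => ?_, fun p hp q hq hpq => hs p (Finset.mem_of_mem_erase hp) q
    (Finset.mem_of_mem_erase hq) hpq, by rw [Finset.card_erase_of_mem hi, hc]; rfl⟩
  have h1 := hb p (Finset.mem_of_mem_erase hp)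
  have h2 := hs p (Finset.mem_of_mem_erase hp) _ hi (Finset.ne_of_mem_erase hp)
  dsimp only at h2
  omega

theorem stripPlacements_succ_succ (m k : ℕ) :
    stripPlacements (m + 1) (k + 1) = stripPlacements m (k + 1) ∪
      ((insert ((0 : Fin 2), m) ·) '' stripPlacements (m - 1) k ∪
        (insert ((1 : Fin 2), m) ·) '' stripPlacements (m - 1) k) := by
  ext S
  constructor
  · intro hS
    by_cases h0 : ((0 : Fin 2), m) ∈ S
    · exact Or.inr (Or.inl ⟨_, erase_mem_stripPlacements hS h0, Finset.insert_erase h0⟩)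
    by_cases h1 : ((1 : Fin 2), m) ∈ S
    · exact Or.inr (Or.inr ⟨_, erase_mem_stripPlacements hS h1, Finset.insert_erase h1⟩)
    refine Or.inl ⟨fun p hp => ?_, hS.2⟩
    refine lt_of_le_of_ne (Nat.le_of_lt_succ (hS.1 p hp)) fun h => ?_
    obtain ⟨i, j⟩ := p
    dsimp only at h
    subst h
    fin_cases i
    · exact h0 hp
    · exact h1 hp
  · rintro (hS | ⟨T, hT, rfl⟩ | ⟨T, hT, rfl⟩)
    · exact ⟨fun p hp => (hS.1 p hp).trans (Nat.lt_succ_self m), hS.2⟩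
    · exact insert_mem_stripPlacements hT 0
    · exact insert_mem_stripPlacements hT 1

theorem encard_image_insert_stripPlacements (m k : ℕ) (i : Fin 2) :
    ((insert (i, m) ·) '' stripPlacements (m - 1) k).encard =
      (stripPlacements (m - 1) k).encard := by
  refine Set.InjOn.encard_image fun S hS T hT h => ?_
  have hn {U} (hU : U ∈ stripPlacements (m - 1) k) : (i, m) ∉ U :=
    notMem_of_mem_stripPlacements hU (Nat.sub_le m 1)
  rw [← Finset.erase_insert (hn hS), ← Finset.erase_insert (hn hT)]
  exact congrArg (Finset.erase · (i, m)) h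

theorem encard_stripPlacements_succ_succ (m k : ℕ) :
    (stripPlacements (m + 1) (k + 1)).encard =
      (stripPlacements m (k + 1)).encard + 2 * (stripPlacements (m - 1) k).encard := by
  rw [stripPlacements_succ_succ, Set.encard_union_eq, Set.encard_union_eq,
    encard_image_insert_stripPlacements, encard_image_insert_stripPlacements, two_mul]
  · refine Set.disjoint_left.2 ?_
    rintro _ ⟨S, hS, rfl⟩ ⟨T, hT, h⟩
    have h0 : ((0 : Fin 2), m) ∈ insert ((1 : Fin 2), m) T := by
      rw [show insert ((1 : Fin 2), m) T = insert ((0 : Fin 2), m) S from h]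
      exact Finset.mem_insert_self _ _
    rcases Finset.mem_insert.1 h0 with h0 | h0
    · simp at h0
    · exact notMem_of_mem_stripPlacements hT (Nat.sub_le m 1) h0
  · refine Set.disjoint_left.2 fun S hS => ?_
    rintro (⟨T, -, rfl⟩ | ⟨T, -, rfl⟩) <;>
      exact notMem_of_mem_stripPlacements hS le_rfl (Finset.mem_insert_self _ _)

theorem encard_stripPlacements (m k : ℕ) :
    (stripPlacements m k).encard = (2 ^ k * (m + 1 - k).choose k : ℕ) := by
  induction m using Nat.strong_induction_on generalizing k with
  | _ m ih =>
    rcases k with _ | k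
    · simp [stripPlacements_zero_right]
    rcases m with _ | m
    · simp [stripPlacements_zero_left_succ]
    rw [encard_stripPlacements_succ_succ, ih m (by omega), ih (m - 1) (by omega)]
    have key : (m + 1 + 1 - (k + 1)).choose (k + 1) =
        (m + 1 - (k + 1)).choose (k + 1) + (m - 1 + 1 - k).choose k := by
      rcases lt_or_ge m k with h | h
      · obtain ⟨k, rfl⟩ : ∃ j, k = j + 1 := ⟨k - 1, by omega⟩
        rw [Nat.choose_eq_zero_of_lt, Nat.choose_eq_zero_of_lt, Nat.choose_eq_zero_of_lt] <;> omega
      rcases m with _ | m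
      · obtain rfl : k = 0 := by omega
        rfl
      · rw [show m + 1 + 1 + 1 - (k + 1) = (m + 1 - k) + 1 by omega, Nat.choose_succ_succ,
          show m + 1 + 1 - (k + 1) = m + 1 - k by omega, Nat.add_sub_cancel, add_comm]
    rw [key]
    push_cast
    ring

theorem two_le_max_dist_iff {n : ℕ} (p q : Fin 2 × Fin n) :
    2 ≤ max (Nat.dist (p.1 : ℕ) (q.1 : ℕ)) (Nat.dist (p.2 : ℕ) (q.2 : ℕ)) ↔
      (p.2 : ℕ) + 2 ≤ q.2 ∨ (q.2 : ℕ) + 2 ≤ p.2 := by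
  have := p.1.isLt
  have := q.1.isLt
  simp only [Nat.dist]
  omega

/-- The inclusion of the two-row strip with `m` columns into the infinite strip. -/
def stripEmbedding (m : ℕ) : Fin 2 × Fin m ↪ Fin 2 × ℕ :=
  (Function.Embedding.refl _).prodMap Fin.valEmbedding

theorem image_map_stripEmbedding (m k : ℕ) :
    Finset.map (stripEmbedding m) '' {S | Nonattacking S ∧ S.card = k} =
      stripPlacements m k := by
  ext T
  constructor
  · rintro ⟨S, ⟨hS, hc⟩, rfl⟩
    refine ⟨fun p hp => ?_, fun p hp q hq hpq => ?_, by rw [Finset.card_map, hc]⟩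
    · obtain ⟨p, -, rfl⟩ := Finset.mem_map.1 hp
      exact p.2.isLt
    · obtain ⟨p, hpS, rfl⟩ := Finset.mem_map.1 hp
      obtain ⟨q, hqS, rfl⟩ := Finset.mem_map.1 hq
      exact (two_le_max_dist_iff p q).1 (hS p hpS q hqS fun h => hpq (congrArg _ h))
  · rintro ⟨hb, hs, hc⟩
    obtain ⟨S, rfl⟩ : ∃ S, Finset.map (stripEmbedding m) S = T := by
      refine ⟨T.preimage _ (stripEmbedding m).injective.injOn, ?_⟩
      ext p
      simp only [Finset.mem_map, Finset.mem_preimage]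
      constructor
      · rintro ⟨q, hq, rfl⟩
        exact hq
      · exact fun hp => ⟨(p.1, ⟨p.2, hb p hp⟩), hp, rfl⟩
    refine ⟨S, ⟨fun p hp q hq hpq => (two_le_max_dist_iff p q).2 ?_, ?_⟩, rfl⟩
    · exact hs _ (Finset.mem_map_of_mem _ hp) _ (Finset.mem_map_of_mem _ hq)
        ((stripEmbedding m).injective.ne hpq)
    · rwa [Finset.card_map] at hc

/-- There are exactly `2^n (n+1)` nonattacking placements of `n` kings
on the `2 × 2n` strip. -/
theorem count_strip_placements (n : ℕ) (hn : 1 ≤ n) :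
    Set.ncard {S : Finset (Fin 2 × Fin (2 * n)) | Nonattacking S ∧ S.card = n}
      = 2 ^ n * (n + 1) := by
  rw [← Set.ncard_image_of_injective _ (Finset.map_injective (stripEmbedding (2 * n))),
    image_map_stripEmbedding, Set.ncard, encard_stripPlacements, ENat.toNat_natCast,
    show 2 * n + 1 - n = n + 1 by omega, Nat.choose_succ_self_right]
end

section
/- Let n ≥ 1, let A, B ⊆ {1,…,n}, and let 1 ≤ k, i ≤ n+1. If the 4×2n placement obtained by stacking S(A,k) on rows 1–2 and S(B,i) on rows 3–4 is nonattacking, then B ⊆ A. -/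
/-- Membership predicate for the `4 × 2n` placement obtained by stacking `S(A,k)` on
rows 0–1 and `S(B,i)` (shifted down by two rows) on rows 2–3. -/
def stackedPred (n : ℕ) (A : Finset ℕ) (k : ℕ) (B : Finset ℕ) (i : ℕ)
    (p : Fin 4 × Fin (2 * n)) : Prop :=
  (∃ q ∈ kingPlacement n A k, (p.1 : ℕ) = (q.1 : ℕ) ∧ (p.2 : ℕ) = (q.2 : ℕ)) ∨
  (∃ q ∈ kingPlacement n B i, (p.1 : ℕ) = (q.1 : ℕ) + 2 ∧ (p.2 : ℕ) = (q.2 : ℕ))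

instance (n : ℕ) (A : Finset ℕ) (k : ℕ) (B : Finset ℕ) (i : ℕ) :
    DecidablePred (stackedPred n A k B i) :=
  fun _ => by unfold stackedPred; infer_instance

/-- The `4 × 2n` placement consisting of `S(A,k)` together with `S(B,i)` shifted
down by two rows. -/
def stackedPlacement (n : ℕ) (A : Finset ℕ) (k : ℕ) (B : Finset ℕ) (i : ℕ) :
    Finset (Fin 4 × Fin (2 * n)) :=
  Finset.univ.filter (stackedPred n A k B i)

/-- The 0-indexed column of the king of `S(A,k)` in block `j`. -/
def kingColumn (k j : ℕ) : ℕ := if j < k then 2 * j - 2 else 2 * j - 1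

theorem kingColumn_lt {n j : ℕ} (hj : j ∈ Finset.Icc 1 n) (k : ℕ) :
    kingColumn k j < 2 * n := by
  rw [Finset.mem_Icc] at hj
  unfold kingColumn
  split_ifs <;> omega

theorem dist_kingColumn_le_one (k i j : ℕ) :
    Nat.dist (kingColumn k j) (kingColumn i j) ≤ 1 := by
  unfold kingColumn Nat.dist
  split_ifs <;> omega

/-- The king of `S(A,k)` in block `j`. -/
theorem king_mem_kingPlacement {n j : ℕ} (hj : j ∈ Finset.Icc 1 n) (A : Finset ℕ) (k : ℕ) :
    ((if j ∈ A then 0 else 1, ⟨kingColumn k j, kingColumn_lt hj k⟩) : Fin 2 × Fin (2 * n)) ∈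
      kingPlacement n A k := by
  refine Finset.mem_filter.mpr ⟨Finset.mem_univ _, j, hj, ?_, rfl⟩
  split_ifs <;> rfl

/-- If stacking `S(A,k)` above `S(B,i)` yields a nonattacking `4 × 2n` placement,
then `B ⊆ A`. -/
theorem stacked_subset (n : ℕ) (hn : 1 ≤ n) (A B : Finset ℕ)
    (hA : A ⊆ Finset.Icc 1 n) (hB : B ⊆ Finset.Icc 1 n) (k i : ℕ)
    (hk : k ∈ Finset.Icc 1 (n + 1)) (hi : i ∈ Finset.Icc 1 (n + 1))
    (hstack : Nonattacking (stackedPlacement n A k B i)) :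
    B ⊆ A := by
  intro j hjB
  by_contra hjA
  have hj := hB hjB
  have hupper : ((1, ⟨kingColumn k j, kingColumn_lt hj k⟩) : Fin 4 × Fin (2 * n)) ∈
      stackedPlacement n A k B i :=
    Finset.mem_filter.mpr ⟨Finset.mem_univ _,
      Or.inl ⟨_, king_mem_kingPlacement hj A k, by simp [hjA], rfl⟩⟩
  have hlower : ((2, ⟨kingColumn i j, kingColumn_lt hj i⟩) : Fin 4 × Fin (2 * n)) ∈
      stackedPlacement n A k B i :=
    Finset.mem_filter.mpr ⟨Finset.mem_univ _,
      Or.inr ⟨_, king_mem_kingPlacement hj B i, by simp [hjB], rfl⟩⟩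
  have hfar := hstack _ hupper _ hlower (by simp)
  have hnear : max (Nat.dist ((1 : Fin 4) : ℕ) ((2 : Fin 4) : ℕ))
      (Nat.dist (kingColumn k j) (kingColumn i j)) ≤ 1 :=
    max_le (by decide) (dist_kingColumn_le_one k i j)
  exact absurd (hfar.trans hnear) (by decide)
end

section
/- Let n ≥ 1, let A ⊆ {1,…,n} and 1 ≤ k ≤ n+1. For B ⊆ {1,…,n} and 1 ≤ i ≤ n+1, the 4×2n placement obtained by stacking S(A,k) on rows 1–2 and S(B,i) on rows 3–4 is nonattacking if and only if B ⊆ A and p(A,B,k) ≤ i ≤ q(A,B,k). -/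
/-- `p(A,B,k) = max({i ∈ {1,…,n+1} : i < k, i ∉ A, i−1 ∈ B} ∪ {1})`. -/
def pFun (n : ℕ) (A B : Finset ℕ) (k : ℕ) : ℕ :=
  (insert 1 ((Finset.Icc 1 (n + 1)).filter (fun i => i < k ∧ i ∉ A ∧ i - 1 ∈ B))).max'
    (Finset.insert_nonempty _ _)

/-- `q(A,B,k) = min({i ∈ {1,…,n+1} : i > k, i ∈ B, i−1 ∉ A} ∪ {n+1})`. -/
def qFun (n : ℕ) (A B : Finset ℕ) (k : ℕ) : ℕ :=
  (insert (n + 1) ((Finset.Icc 1 (n + 1)).filter (fun i => k < i ∧ i ∈ B ∧ i - 1 ∉ A))).min'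
    (Finset.insert_nonempty _ _)

theorem mem_kingPlacement_iff {n k : ℕ} {A : Finset ℕ} {p : Fin 2 × Fin (2 * n)} :
    p ∈ kingPlacement n A k ↔ ∃ j, (1 ≤ j ∧ j ≤ n) ∧
      (p.1 : ℕ) = (if j ∈ A then 0 else 1) ∧
      (p.2 : ℕ) = (if j < k then 2 * j - 2 else 2 * j - 1) := by
  simp [kingPlacement, kingPred]

theorem mem_stackedPlacement_iff {n k i : ℕ} {A B : Finset ℕ} {p : Fin 4 × Fin (2 * n)} :
    p ∈ stackedPlacement n A k B i ↔ ∃ j, (1 ≤ j ∧ j ≤ n) ∧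
      (((p.1 : ℕ) = (if j ∈ A then 0 else 1) ∧
          (p.2 : ℕ) = (if j < k then 2 * j - 2 else 2 * j - 1)) ∨
        ((p.1 : ℕ) = (if j ∈ B then 2 else 3) ∧
          (p.2 : ℕ) = (if j < i then 2 * j - 2 else 2 * j - 1))) := by
  simp only [stackedPlacement, stackedPred, Finset.mem_filter, Finset.mem_univ, true_and,
    mem_kingPlacement_iff]
  constructor
  · rintro (⟨q, ⟨j, hj, h1, h2⟩, h3, h4⟩ | ⟨q, ⟨j, hj, h1, h2⟩, h3, h4⟩)
    · exact ⟨j, hj, .inl ⟨h3.trans h1, h4.trans h2⟩⟩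
    · refine ⟨j, hj, .inr ⟨?_, h4.trans h2⟩⟩
      split_ifs at h1 ⊢ <;> omega
  · rintro ⟨j, hj, ⟨h1, h2⟩ | ⟨h1, h2⟩⟩
    · refine .inl ⟨(⟨p.1, ?_⟩, p.2), ⟨j, hj, h1, h2⟩, rfl, rfl⟩
      split_ifs at h1 <;> omega
    · refine .inr ⟨(⟨p.1 - 2, ?_⟩, p.2), ⟨j, hj, ?_, h2⟩, ?_, rfl⟩ <;> grind

/-- Only a king in the second row and a king in the third row of the stacked placement
can attack each other. -/
theorem nonattacking_stackedPlacement_iff {n k i : ℕ} {A B : Finset ℕ} :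
    Nonattacking (stackedPlacement n A k B i) ↔
      ∀ a b, 1 ≤ a → a ≤ n → 1 ≤ b → b ≤ n → a ∉ A → b ∈ B →
        2 ≤ Nat.dist (if a < k then 2 * a - 2 else 2 * a - 1)
          (if b < i then 2 * b - 2 else 2 * b - 1) := by
  constructor
  · intro h a b ha han hb hbn haA hbB
    have hca : (if a < k then 2 * a - 2 else 2 * a - 1) < 2 * n := by split_ifs <;> omega
    have hcb : (if b < i then 2 * b - 2 else 2 * b - 1) < 2 * n := by split_ifs <;> omega
    have key := h (1, ⟨_, hca⟩)
      (mem_stackedPlacement_iff.2 ⟨a, ⟨ha, han⟩, .inl ⟨by simp [haA], rfl⟩⟩) (2, ⟨_, hcb⟩)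
      (mem_stackedPlacement_iff.2 ⟨b, ⟨hb, hbn⟩, .inr ⟨by simp [hbB], rfl⟩⟩)
      (by simp [Prod.ext_iff])
    rcases le_max_iff.1 key with h' | h'
    · simp [Nat.dist] at h'
    · exact h'
  · rintro h ⟨r, c⟩ hp ⟨r', c'⟩ hq hne
    obtain ⟨a, ⟨ha, han⟩, hpa⟩ := mem_stackedPlacement_iff.1 hp
    obtain ⟨b, ⟨hb, hbn⟩, hqb⟩ := mem_stackedPlacement_iff.1 hq
    have hne' : (r : ℕ) ≠ r' ∨ (c : ℕ) ≠ c' := by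
      by_contra! hc
      exact hne (Prod.ext (Fin.ext hc.1) (Fin.ext hc.2))
    have hab := h a b ha han hb hbn
    have hba := h b a hb hbn ha han
    rw [le_max_iff]
    dsimp only [Nat.dist] at *
    rcases hpa with ⟨h1, h2⟩ | ⟨h1, h2⟩ <;> rcases hqb with ⟨h3, h4⟩ | ⟨h3, h4⟩
    · rcases eq_or_ne a b with rfl | hn
      · omega
      · right; clear h1 h3 hab hba; split_ifs at h2 h4 <;> omega
    · by_cases hA : a ∈ A
      · left; rw [if_pos hA] at h1; split_ifs at h3 <;> omega
      · by_cases hB : b ∈ B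
        · right; rw [h2, h4]; exact hab hA hB
        · left; rw [if_neg hB] at h3; split_ifs at h1; omega
    · by_cases hA : b ∈ A
      · left; rw [if_pos hA] at h3; split_ifs at h1 <;> omega
      · by_cases hB : a ∈ B
        · right; rw [h2, h4, add_comm]; exact hba hA hB
        · left; rw [if_neg hB] at h1; split_ifs at h3; omega
    · rcases eq_or_ne a b with rfl | hn
      · omega
      · right; clear h1 h3 hab hba; split_ifs at h2 h4 <;> omega

theorem pFun_le_iff {n k i : ℕ} {A B : Finset ℕ} (hi : 1 ≤ i) :
    pFun n A B k ≤ i ↔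
      ∀ j, 1 ≤ j → j ≤ n + 1 → j < k → j ∉ A → j - 1 ∈ B → j ≤ i := by
  simp [pFun, Finset.max'_le_iff, hi]

theorem le_qFun_iff {n k i : ℕ} {A B : Finset ℕ} (hi : i ≤ n + 1) :
    i ≤ qFun n A B k ↔
      ∀ j, 1 ≤ j → j ≤ n + 1 → k < j → j ∈ B → j - 1 ∉ A → i ≤ j := by
  simp [qFun, Finset.le_min'_iff, hi]

/-- Stacking `S(A,k)` above `S(B,i)` yields a nonattacking `4 × 2n` placement
if and only if `B ⊆ A` and `p(A,B,k) ≤ i ≤ q(A,B,k)`. -/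
theorem stacked_nonattacking_iff (n : ℕ) (hn : 1 ≤ n) (A : Finset ℕ)
    (hA : A ⊆ Finset.Icc 1 n) (k : ℕ) (hk : k ∈ Finset.Icc 1 (n + 1))
    (B : Finset ℕ) (hB : B ⊆ Finset.Icc 1 n) (i : ℕ) (hi : i ∈ Finset.Icc 1 (n + 1)) :
    Nonattacking (stackedPlacement n A k B i) ↔
      B ⊆ A ∧ pFun n A B k ≤ i ∧ i ≤ qFun n A B k := by
  rw [Finset.mem_Icc] at hk hi
  rw [nonattacking_stackedPlacement_iff, pFun_le_iff hi.1, le_qFun_iff hi.2]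
  have hBn : ∀ b ∈ B, 1 ≤ b ∧ b ≤ n := fun b hb => Finset.mem_Icc.1 (hB hb)
  constructor
  · intro h
    refine ⟨fun b hb => ?_, fun j _ _ hjk hjA hjB => ?_, fun j _ _ hkj hjB hjA => ?_⟩
    · by_contra hbA
      obtain ⟨hb1, hbn⟩ := hBn b hb
      have := h b b hb1 hbn hb1 hbn hbA hb
      unfold Nat.dist at this
      split_ifs at this <;> omega
    · by_contra! hij
      obtain ⟨hb1, hbn⟩ := hBn _ hjB
      have := h j (j - 1) (by omega) (by omega) hb1 hbn hjA hjB
      rw [if_pos hjk, if_neg (by omega)] at this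
      unfold Nat.dist at this
      omega
    · by_contra! hij
      obtain ⟨hb1, hbn⟩ := hBn _ hjB
      have := h (j - 1) j (by omega) (by omega) hb1 hbn hjA hjB
      rw [if_neg (by omega), if_pos hij] at this
      unfold Nat.dist at this
      omega
  · rintro ⟨hBA, hp, hq⟩ a b ha han hb hbn haA hbB
    have hne : a ≠ b := fun hab => haA (hab ▸ hBA hbB)
    have hp' : a = b + 1 → a < k → a ≤ i := fun hab hak =>
      hp a ha (by omega) hak haA (by rwa [hab, Nat.add_sub_cancel])
    have hq' : b = a + 1 → k < b → i ≤ b := fun hab hkb =>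
      hq b hb (by omega) hkb hbB (by rwa [hab, Nat.add_sub_cancel])
    unfold Nat.dist
    split_ifs <;> omega
end

section
/- Let n ≥ 1 and let S be a nonattacking placement of exactly n² kings on the 2n×2n chessboard. Then for each pair of block indices 1 ≤ r, c ≤ n, the 2×2 square consisting of rows 2r−1, 2r and columns 2c−1, 2c (1-indexed) contains exactly one king of S. -/
open scoped Classical

/-- Two kings of a nonattacking placement never share a 2×2 block. -/
theorem Nonattacking.injOn_block {m n : ℕ} {S : Finset (Fin m × Fin n)} (hS : Nonattacking S) :
    Set.InjOn (fun p : Fin m × Fin n => ((p.1 : ℕ) / 2, (p.2 : ℕ) / 2)) S := by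
  intro p hp q hq hpq
  by_contra hne
  have h := hS p hp q hq hne
  simp only [Prod.mk.injEq] at hpq
  simp only [Nat.dist] at h
  omega

/-- In a nonattacking placement of `n²` kings on the `2n × 2n` board, each of the
`n²` disjoint 2×2 squares — the `(r,c)`-th square has 1-indexed rows `2r−1, 2r` and
columns `2c−1, 2c` (i.e. 0-indexed rows `2r−2, 2r−1` and columns `2c−2, 2c−1`) —
contains exactly one king. -/
theorem one_king_per_block (n : ℕ) (hn : 1 ≤ n)
    (S : Finset (Fin (2 * n) × Fin (2 * n))) (hS : Nonattacking S)
    (hcard : S.card = n ^ 2) :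
    ∀ r ∈ Finset.Icc 1 n, ∀ c ∈ Finset.Icc 1 n,
      (S.filter (fun p => ((p.1 : ℕ) = 2 * r - 2 ∨ (p.1 : ℕ) = 2 * r - 1) ∧
        ((p.2 : ℕ) = 2 * c - 2 ∨ (p.2 : ℕ) = 2 * c - 1))).card = 1 := by
  intro r hr c hc
  rw [Finset.mem_Icc] at hr hc
  have hinj := hS.injOn_block
  have hmaps : Set.MapsTo (fun p : Fin (2 * n) × Fin (2 * n) => ((p.1 : ℕ) / 2, (p.2 : ℕ) / 2))
      S (Finset.range n ×ˢ Finset.range n : Finset (ℕ × ℕ)) := by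
    intro p _
    simp only [Finset.mem_coe, Finset.mem_product, Finset.mem_range]
    omega
  have hsurj := Finset.surjOn_of_injOn_of_card_le _ hmaps hinj
    (by simp [hcard, sq])
  have hrc : (r - 1, c - 1) ∈ (Finset.range n ×ˢ Finset.range n : Finset (ℕ × ℕ)) := by
    simp only [Finset.mem_product, Finset.mem_range]
    omega
  obtain ⟨p, hp, hpb⟩ := hsurj hrc
  simp only [Prod.mk.injEq] at hpb
  rw [Finset.card_eq_one]
  refine ⟨p, Finset.eq_singleton_iff_unique_mem.2 ⟨Finset.mem_filter.2 ⟨hp, by omega⟩, ?_⟩⟩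
  intro q hq
  rw [Finset.mem_filter] at hq
  refine hinj hq.1 hp ?_
  simp only [Prod.mk.injEq]
  omega
end
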